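/- arXiv:1008.3443 — 2 statements merged into one kernel-verified Lean document; each statement's English description precedes it below -/
import Mathlib

section
/- For a partition 𝒞 of V, t(𝒞) = 0 if and only if 𝒞 ⪯ ℬ, where ℬ is the partition of V into the connected components of the graph G (with edge (l,r) iff m(l,r)>0). -/
open Finset

variable {V : Type*} [Fintype V] [DecidableEq V]

noncomputable section

/-- `Z = ∑_{l,r} m(l,r)` as a real number. -/
def Zval (m : V → V → ℕ) : ℝ := ∑ l : V, ∑ r : V, (m l r : ℝ)

/-- The probability measure `m_E` on `V × V`. -/
def mE (m : V → V → ℕ) (S : Finset (V × V)) : ℝ :=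
  (∑ p ∈ S, (m p.1 p.2 : ℝ)) / Zval m

/-- The marginal probability `m_V` on `V`. -/
def mV (m : V → V → ℕ) (A : Finset V) : ℝ := mE m (A ×ˢ Finset.univ)

/-- The product measure `m_VV` on `V × V`. -/
def mVV (m : V → V → ℕ) (S : Finset (V × V)) : ℝ :=
  ∑ p ∈ S, mV m {p.1} * mV m {p.2}

/-- The signed measure `μ_t = m_E - t · m_VV`. -/
def mu (m : V → V → ℕ) (t : ℝ) (S : Finset (V × V)) : ℝ := mE m S - t * mVV m S

/-- `ρ(C) = m_E(C × (V ∖ C))`. -/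
def rho (m : V → V → ℕ) (C : Finset V) : ℝ := mE m (C ×ˢ (Finset.univ \ C))

/-- A partition of `V`: pairwise disjoint nonempty sets covering `V`. -/
def IsPartition (𝒞 : Finset (Finset V)) : Prop :=
  (∀ C ∈ 𝒞, C.Nonempty) ∧
  (∀ C ∈ 𝒞, ∀ C' ∈ 𝒞, C ≠ C' → Disjoint C C') ∧
  𝒞.sup id = Finset.univ

/-- The diagonal set `D(𝒞) = ∪_{C ∈ 𝒞} C × C`. -/
def Dset (𝒞 : Finset (Finset V)) : Finset (V × V) := 𝒞.sup fun C => C ×ˢ C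

/-- The modularity at resolution `t`: `Q_t(𝒞) = μ_t(D(𝒞))`. -/
def Qmod (m : V → V → ℕ) (t : ℝ) (𝒞 : Finset (Finset V)) : ℝ := mu m t (Dset 𝒞)

/-- The complement `Q̄_t(𝒞) = μ_t(D̄(𝒞))`. -/
def Qbar (m : V → V → ℕ) (t : ℝ) (𝒞 : Finset (Finset V)) : ℝ :=
  mu m t (Finset.univ \ Dset 𝒞)

/-- `𝒞` is submodular for `μ_t`: `μ_t(C × C') ≤ 0` for distinct `C, C' ∈ 𝒞`. -/
def Submodular (m : V → V → ℕ) (t : ℝ) (𝒞 : Finset (Finset V)) : Prop :=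
  ∀ C ∈ 𝒞, ∀ C' ∈ 𝒞, C ≠ C' → mu m t (C ×ˢ C') ≤ 0

/-- `Coarsens 𝒞 𝒟` means `𝒞 ⪯ 𝒟`, i.e. `𝒟` refines `𝒞`:
every element of `𝒞` is the union of the elements of `𝒟` it contains. -/
def Coarsens (𝒞 𝒟 : Finset (Finset V)) : Prop :=
  ∀ C ∈ 𝒞, C = (𝒟.filter fun D => D ⊆ C).sup id

/-- The resolution `t(𝒞)`: the maximum of `m_E(C×C') / m_VV(C×C')` over distinct
pairs of parts (`0` when there are no such pairs, e.g. `|𝒞| = 1`). -/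
def resol (m : V → V → ℕ) (𝒞 : Finset (Finset V)) : ℝ :=
  ⨆ p : {p : Finset V × Finset V // p.1 ∈ 𝒞 ∧ p.2 ∈ 𝒞 ∧ p.1 ≠ p.2},
    mE m ((p : Finset V × Finset V).1 ×ˢ (p : Finset V × Finset V).2) /
      mVV m ((p : Finset V × Finset V).1 ×ˢ (p : Finset V × Finset V).2)

/-- The graph `G` associated to `m`: an edge between `l ≠ r` iff `m(l,r) > 0`
(for symmetric `m` this is exactly the graph of the paper). -/
def graphOf (m : V → V → ℕ) : SimpleGraph V :=
  SimpleGraph.fromRel fun l r => 0 < m l r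

/-- `α(𝒞) = m_VV(D(𝒞)) = ∑_{C ∈ 𝒞} m_V(C)²`. -/
def alphaP (m : V → V → ℕ) (𝒞 : Finset (Finset V)) : ℝ := mVV m (Dset 𝒞)

open scoped Classical in
/-- `Z₀(𝒞)` at resolution `t`: the pairs of distinct parts with `μ_t(C × C') = 0`. -/
def Z0 (m : V → V → ℕ) (t : ℝ) (𝒞 : Finset (Finset V)) :
    Finset (Finset V × Finset V) :=
  (𝒞 ×ˢ 𝒞).filter fun p => p.1 ≠ p.2 ∧ mu m t (p.1 ×ˢ p.2) = 0

/-- The value `c*` of the minimum cut of `G` with weights `m`. -/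
def mincut (m : V → V → ℕ) : ℝ :=
  ⨅ S : {S : Finset V // S.Nonempty ∧ S ≠ Finset.univ},
    ∑ l ∈ (S : Finset V), ∑ r ∈ Finset.univ \ (S : Finset V), (m l r : ℝ)

end

theorem mVV_product_pos (m : V → V → ℕ) (hdeg : ∀ l : V, 0 < ∑ r : V, m l r)
    {C C' : Finset V} (hC : C.Nonempty) (hC' : C'.Nonempty) : 0 < mVV m (C ×ˢ C') := by
  have hdeg' : ∀ l : V, (0 : ℝ) < ∑ r : V, (m l r : ℝ) := fun l => by exact_mod_cast hdeg l
  obtain ⟨l, hl⟩ := hC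
  have hZ : 0 < Zval m := Finset.sum_pos (fun l _ => hdeg' l) ⟨l, Finset.mem_univ l⟩
  have hV : ∀ v : V, 0 < mV m {v} := fun v => by
    unfold mV mE
    rw [Finset.sum_product, Finset.sum_singleton]
    exact div_pos (hdeg' v) hZ
  exact Finset.sum_pos (fun p _ => mul_pos (hV p.1) (hV p.2))
    (Finset.Nonempty.product ⟨l, hl⟩ hC')

theorem mE_nonneg (m : V → V → ℕ) (S : Finset (V × V)) : 0 ≤ mE m S := by
  unfold mE Zval
  positivity

theorem mE_eq_zero_iff (m : V → V → ℕ) (hZ : 0 < ∑ l : V, ∑ r : V, m l r)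
    (S : Finset (V × V)) : mE m S = 0 ↔ ∀ p ∈ S, m p.1 p.2 = 0 := by
  have hZ' : Zval m ≠ 0 := by
    unfold Zval
    exact_mod_cast hZ.ne'
  unfold mE
  rw [div_eq_zero_iff, or_iff_left hZ', Finset.sum_eq_zero_iff_of_nonneg fun _ _ => by positivity]
  simp only [Nat.cast_eq_zero]

/-- The resolution vanishes exactly when no edge joins two distinct parts. -/
theorem resol_eq_zero_iff (m : V → V → ℕ) (hZ : 0 < ∑ l : V, ∑ r : V, m l r)
    (hdeg : ∀ l : V, 0 < ∑ r : V, m l r) (𝒞 : Finset (Finset V)) (h𝒞 : ∀ C ∈ 𝒞, C.Nonempty) :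
    resol m 𝒞 = 0 ↔
      ∀ C ∈ 𝒞, ∀ C' ∈ 𝒞, C ≠ C' → ∀ l ∈ C, ∀ r ∈ C', m l r = 0 := by
  constructor
  · intro h C hC C' hC' hne l hl r hr
    have hVV := mVV_product_pos m hdeg (h𝒞 C hC) (h𝒞 C' hC')
    have hle : mE m (C ×ˢ C') / mVV m (C ×ˢ C') ≤ 0 := by
      rw [← h]
      exact le_ciSup
        (f := fun p : {p : Finset V × Finset V // p.1 ∈ 𝒞 ∧ p.2 ∈ 𝒞 ∧ p.1 ≠ p.2} =>
          mE m (p.1.1 ×ˢ p.1.2) / mVV m (p.1.1 ×ˢ p.1.2))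
        (Set.finite_range _).bddAbove ⟨(C, C'), hC, hC', hne⟩
    have hE : mE m (C ×ˢ C') = 0 := by
      refine le_antisymm ?_ (mE_nonneg m _)
      simpa using (div_le_iff₀ hVV).1 hle
    exact (mE_eq_zero_iff m hZ _).1 hE (l, r) (Finset.mk_mem_product hl hr)
  · intro h
    have hzero : ∀ p : {p : Finset V × Finset V // p.1 ∈ 𝒞 ∧ p.2 ∈ 𝒞 ∧ p.1 ≠ p.2},
        mE m (p.1.1 ×ˢ p.1.2) / mVV m (p.1.1 ×ˢ p.1.2) = 0 := by
      rintro ⟨⟨C, C'⟩, hC, hC', hne⟩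
      have hE : mE m (C ×ˢ C') = 0 := (mE_eq_zero_iff m hZ _).2 fun p hp =>
        h C hC C' hC' hne _ (Finset.mem_product.1 hp).1 _ (Finset.mem_product.1 hp).2
      simp [hE]
    unfold resol
    simp only [hzero, Real.iSup_const_zero]

theorem forall_parts_iff_forall_notMem (m : V → V → ℕ) {𝒞 : Finset (Finset V)}
    (h𝒞 : IsPartition 𝒞) :
    (∀ C ∈ 𝒞, ∀ C' ∈ 𝒞, C ≠ C' → ∀ l ∈ C, ∀ r ∈ C', m l r = 0) ↔
      ∀ C ∈ 𝒞, ∀ l ∈ C, ∀ r, r ∉ C → m l r = 0 := by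
  constructor
  · intro h C hC l hl r hr
    have hmem : r ∈ 𝒞.sup id := h𝒞.2.2 ▸ Finset.mem_univ r
    obtain ⟨C', hC', hr'⟩ := Finset.mem_sup.1 hmem
    exact h C hC C' hC' (fun e => hr (e ▸ hr')) l hl r hr'
  · intro h C hC C' hC' hne l hl r hr
    exact h C hC l hl r fun hrC =>
      Finset.disjoint_left.1 (h𝒞.2.1 C hC C' hC' hne) hrC hr

theorem graphOf_adj (m : V → V → ℕ) (hsym : ∀ l r, m l r = m r l) (l r : V) :
    (graphOf m).Adj l r ↔ l ≠ r ∧ 0 < m l r := by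
  simp [graphOf, SimpleGraph.fromRel_adj, hsym r l]

/-- A set that no edge leaves contains everything reachable from its elements. -/
theorem mem_of_reachable_graphOf (m : V → V → ℕ) (hsym : ∀ l r, m l r = m r l) {C : Finset V}
    (hC : ∀ l ∈ C, ∀ r, r ∉ C → m l r = 0) {l r : V} (h : (graphOf m).Reachable l r)
    (hl : l ∈ C) : r ∈ C := by
  obtain ⟨w⟩ := h
  induction w with
  | nil => exact hl
  | cons hadj _ ih =>
    refine ih ?_
    by_contra hnot
    exact ((graphOf_adj m hsym _ _).1 hadj).2.ne' (hC _ hl _ hnot)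

/-- For a partition `𝒞` of `V`, `t(𝒞) = 0` iff `𝒞 ⪯ ℬ`, where
`ℬ` is the partition of `V` into the connected components of `G`. -/
theorem stmt_17 (m : V → V → ℕ) (hsym : ∀ l r, m l r = m r l)
    (hZ : 0 < ∑ l : V, ∑ r : V, m l r) (hdeg : ∀ l : V, 0 < ∑ r : V, m l r)
    (𝒞 : Finset (Finset V)) (h𝒞 : IsPartition 𝒞)
    (ℬ : Finset (Finset V))
    (hB : ∀ B : Finset V, B ∈ ℬ ↔
      B.Nonempty ∧ ((graphOf m).induce (B : Set V)).Connected ∧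
        ∀ l ∈ B, ∀ r, r ∉ B → m l r = 0) :
    resol m 𝒞 = 0 ↔ Coarsens 𝒞 ℬ := by
  classical
  rw [resol_eq_zero_iff m hZ hdeg 𝒞 h𝒞.1, forall_parts_iff_forall_notMem m h𝒞]
  constructor
  · intro h C hC
    ext l
    simp only [Finset.mem_sup, Finset.mem_filter, id]
    refine ⟨fun hl => ?_, fun ⟨B, ⟨_, hBC⟩, hlB⟩ => hBC hlB⟩
    let c := (graphOf m).connectedComponentMk l
    have hmem : ∀ v, v ∈ c.supp.toFinset ↔ (graphOf m).Reachable v l := fun v => by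
      simp [c, SimpleGraph.ConnectedComponent.mem_supp_iff]
    refine ⟨c.supp.toFinset, ⟨(hB _).2 ⟨⟨l, (hmem l).2 (.refl l)⟩, ?_, ?_⟩, ?_⟩,
      (hmem l).2 (.refl l)⟩
    · rw [Set.coe_toFinset]
      exact c.connected_toSimpleGraph
    · intro u hu r hr
      by_contra hne
      refine hr ((hmem r).2 (.trans (SimpleGraph.Adj.reachable ?_) ((hmem u).1 hu)))
      rw [SimpleGraph.adj_comm, graphOf_adj m hsym]
      exact ⟨fun e => hr (e ▸ hu), Nat.pos_of_ne_zero hne⟩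
    · exact fun v hv => mem_of_reachable_graphOf m hsym (h C hC) ((hmem v).1 hv).symm hl
  · intro h C hC l hl r hr
    rw [h C hC] at hl
    simp only [Finset.mem_sup, Finset.mem_filter, id] at hl
    obtain ⟨B, ⟨hBmem, hBC⟩, hlB⟩ := hl
    exact ((hB B).1 hBmem).2.2 l hlB r fun hrB => hr (hBC hrB)
end

section
/- Let 𝒞 be a partition of V with t = t(𝒞) > 0, let (C,C') ∈ Z₀(𝒞), and let 𝒟 = (𝒞∖{C,C'}) ∪ {C∪C'} be the partition obtained by merging C and C'. Then 𝒟 is submodular for μ_t, |𝒟| = |𝒞| − 1, |Z₀(𝒟)| < |Z₀(𝒞)|, Q_t(𝒟) = Q_t(𝒞), α(𝒟) = α(𝒞) + 2·m_VV(C×C'), and for every 0 < s < t, Q_s(𝒟) > Q_s(𝒞). -/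
open Finset

variable {V : Type*} [Fintype V] [DecidableEq V]

theorem mE_union (m : V → V → ℕ) {S T : Finset (V × V)} (h : Disjoint S T) :
    mE m (S ∪ T) = mE m S + mE m T := by
  simp only [mE, Finset.sum_union h, add_div]

theorem mVV_union (m : V → V → ℕ) {S T : Finset (V × V)} (h : Disjoint S T) :
    mVV m (S ∪ T) = mVV m S + mVV m T :=
  Finset.sum_union h

theorem mu_union (m : V → V → ℕ) (t : ℝ) {S T : Finset (V × V)} (h : Disjoint S T) :
    mu m t (S ∪ T) = mu m t S + mu m t T := by
  simp only [mu, mE_union m h, mVV_union m h]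
  ring

theorem mE_product_swap (m : V → V → ℕ) (hsym : ∀ l r, m l r = m r l) (A B : Finset V) :
    mE m (A ×ˢ B) = mE m (B ×ˢ A) := by
  rw [mE, mE, Finset.sum_product_right, Finset.sum_product]
  simp only [hsym]

theorem mVV_product_swap (m : V → V → ℕ) (A B : Finset V) :
    mVV m (A ×ˢ B) = mVV m (B ×ˢ A) := by
  simp only [mVV, Finset.sum_product_right (s := A), Finset.sum_product (s := B), mul_comm]

theorem mu_product_swap (m : V → V → ℕ) (hsym : ∀ l r, m l r = m r l) (t : ℝ)
    (A B : Finset V) : mu m t (A ×ˢ B) = mu m t (B ×ˢ A) := by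
  simp only [mu, mE_product_swap m hsym A B, mVV_product_swap m A B]

theorem mu_union_product (m : V → V → ℕ) (t : ℝ) {A B : Finset V} (h : Disjoint A B)
    (Y : Finset V) : mu m t ((A ∪ B) ×ˢ Y) = mu m t (A ×ˢ Y) + mu m t (B ×ˢ Y) := by
  rw [Finset.union_product, mu_union]
  exact Finset.disjoint_product.2 (Or.inl h)

theorem mu_product_union (m : V → V → ℕ) (t : ℝ) {A B : Finset V} (h : Disjoint A B)
    (X : Finset V) : mu m t (X ×ˢ (A ∪ B)) = mu m t (X ×ˢ A) + mu m t (X ×ˢ B) := by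
  rw [Finset.product_union, mu_union]
  exact Finset.disjoint_product.2 (Or.inr h)

theorem mV_singleton_pos (m : V → V → ℕ) (hZ : 0 < ∑ l : V, ∑ r : V, m l r)
    (hdeg : ∀ l : V, 0 < ∑ r : V, m l r) (l : V) : 0 < mV m {l} := by
  have hZ' : 0 < Zval m := by unfold Zval; exact_mod_cast hZ
  have hl : (0 : ℝ) < ∑ r : V, (m l r : ℝ) := by exact_mod_cast hdeg l
  simp only [mV, mE, Finset.sum_product, Finset.sum_singleton]
  exact div_pos hl hZ'

theorem mVV_product_pos_s18 (m : V → V → ℕ) (hZ : 0 < ∑ l : V, ∑ r : V, m l r)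
    (hdeg : ∀ l : V, 0 < ∑ r : V, m l r) {A B : Finset V} (hA : A.Nonempty)
    (hB : B.Nonempty) : 0 < mVV m (A ×ˢ B) :=
  Finset.sum_pos (fun p _ => mul_pos (mV_singleton_pos m hZ hdeg p.1)
    (mV_singleton_pos m hZ hdeg p.2)) (hA.product hB)

/-- A partition is submodular at its own resolution. -/
theorem submodular_resol (m : V → V → ℕ) (hZ : 0 < ∑ l : V, ∑ r : V, m l r)
    (hdeg : ∀ l : V, 0 < ∑ r : V, m l r) {𝒞 : Finset (Finset V)}
    (h𝒞 : ∀ C ∈ 𝒞, C.Nonempty) : Submodular m (resol m 𝒞) 𝒞 := by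
  intro A hA B hB hAB
  have hle : mE m (A ×ˢ B) / mVV m (A ×ˢ B) ≤ resol m 𝒞 :=
    le_ciSup (f := fun p : {p : Finset V × Finset V // p.1 ∈ 𝒞 ∧ p.2 ∈ 𝒞 ∧ p.1 ≠ p.2} =>
      mE m (p.1.1 ×ˢ p.1.2) / mVV m (p.1.1 ×ˢ p.1.2)) (Set.finite_range _).bddAbove
      ⟨(A, B), hA, hB, hAB⟩
  rw [div_le_iff₀ (mVV_product_pos_s18 m hZ hdeg (h𝒞 A hA) (h𝒞 B hB))] at hle
  exact sub_nonpos.2 hle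

theorem mem_Z0 {m : V → V → ℕ} {t : ℝ} {𝒞 : Finset (Finset V)} {p : Finset V × Finset V} :
    p ∈ Z0 m t 𝒞 ↔ (p.1 ∈ 𝒞 ∧ p.2 ∈ 𝒞) ∧ p.1 ≠ p.2 ∧ mu m t (p.1 ×ˢ p.2) = 0 := by
  simp [Z0]

theorem mem_Dset {𝒞 : Finset (Finset V)} {p : V × V} :
    p ∈ Dset 𝒞 ↔ ∃ A ∈ 𝒞, p.1 ∈ A ∧ p.2 ∈ A := by
  simp [Dset, Finset.mem_sup]

/-- Merging two parts adds the two off-diagonal rectangles to the diagonal set. -/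
theorem Dset_merge {𝒞 : Finset (Finset V)} {C C' : Finset V} (hC : C ∈ 𝒞) (hC' : C' ∈ 𝒞) :
    Dset (insert (C ∪ C') (𝒞 \ {C, C'})) = Dset 𝒞 ∪ (C ×ˢ C' ∪ C' ×ˢ C) := by
  ext ⟨x, y⟩
  simp only [mem_Dset, Finset.mem_union, Finset.mem_product, Finset.mem_insert,
    Finset.mem_sdiff, Finset.mem_singleton]
  constructor
  · rintro ⟨A, rfl | ⟨hA, -⟩, hx, hy⟩
    · rw [Finset.mem_union] at hx hy
      grind
    · exact Or.inl ⟨A, hA, hx, hy⟩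
  · rintro (⟨A, hA, hx, hy⟩ | h)
    · by_cases h : A = C ∨ A = C'
      · exact ⟨C ∪ C', Or.inl rfl, by grind, by grind⟩
      · exact ⟨A, Or.inr ⟨hA, h⟩, hx, hy⟩
    · exact ⟨C ∪ C', Or.inl rfl, by grind, by grind⟩

theorem disjoint_Dset_product {𝒞 : Finset (Finset V)}
    (hd : ∀ C ∈ 𝒞, ∀ C' ∈ 𝒞, C ≠ C' → Disjoint C C') {C C' : Finset V}
    (hC : C ∈ 𝒞) (hC' : C' ∈ 𝒞) (hne : C ≠ C') : Disjoint (Dset 𝒞) (C ×ˢ C') := by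
  rw [Finset.disjoint_left]
  rintro ⟨x, y⟩ h h'
  obtain ⟨A, hA, hx, hy⟩ := mem_Dset.1 h
  obtain ⟨hx', hy'⟩ := Finset.mem_product.1 h'
  have hAC : A = C := by
    by_contra hn
    exact Finset.disjoint_left.1 (hd A hA C hC hn) hx hx'
  have hAC' : A = C' := by
    by_contra hn
    exact Finset.disjoint_left.1 (hd A hA C' hC' hn) hy hy'
  exact hne (hAC.symm.trans hAC')

/-- Let `𝒞` be a partition of `V` with `t = t(𝒞) > 0`, let
`(C,C') ∈ Z₀(𝒞)` and let `𝒟 = (𝒞∖{C,C'}) ∪ {C∪C'}`. Then `𝒟` is submodular for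
`μ_t`, `|𝒟| = |𝒞| − 1`, `|Z₀(𝒟)| < |Z₀(𝒞)|`, `Q_t(𝒟) = Q_t(𝒞)`,
`α(𝒟) = α(𝒞) + 2·m_VV(C×C')`, and `Q_s(𝒟) > Q_s(𝒞)` for `0 < s < t`. -/
theorem stmt_18 (m : V → V → ℕ) (hsym : ∀ l r, m l r = m r l)
    (hZ : 0 < ∑ l : V, ∑ r : V, m l r) (hdeg : ∀ l : V, 0 < ∑ r : V, m l r)
    (𝒞 : Finset (Finset V)) (h𝒞 : IsPartition 𝒞)
    (t : ℝ) (htc : t = resol m 𝒞) (ht : 0 < t)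
    (C C' : Finset V) (hCC' : (C, C') ∈ Z0 m t 𝒞)
    (𝒟 : Finset (Finset V)) (h𝒟 : 𝒟 = insert (C ∪ C') (𝒞 \ {C, C'})) :
    Submodular m t 𝒟 ∧
    𝒟.card = 𝒞.card - 1 ∧
    (Z0 m t 𝒟).card < (Z0 m t 𝒞).card ∧
    Qmod m t 𝒟 = Qmod m t 𝒞 ∧
    alphaP m 𝒟 = alphaP m 𝒞 + 2 * mVV m (C ×ˢ C') ∧
    (∀ s : ℝ, 0 < s → s < t → Qmod m s 𝒞 < Qmod m s 𝒟) := by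
  obtain ⟨⟨hC, hC'⟩, hne, hmu⟩ := mem_Z0.1 hCC'
  obtain ⟨hnon, hd, -⟩ := h𝒞
  simp only at hC hC' hne hmu
  have hsub : Submodular m t 𝒞 := htc ▸ submodular_resol m hZ hdeg hnon
  have hdis : Disjoint C C' := hd C hC C' hC' hne
  have hVV : 0 < mVV m (C ×ˢ C') := mVV_product_pos_s18 m hZ hdeg (hnon C hC) (hnon C' hC')
  have hne_left : C ∪ C' ≠ C := by
    intro h
    exact (hnon C' hC').ne_empty (hdis.symm.eq_bot_of_le (Finset.union_eq_left.1 h))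
  have hnot : C ∪ C' ∉ 𝒞 := by
    intro h
    obtain ⟨x, hx⟩ := hnon C hC
    exact Finset.disjoint_left.1 (hd _ h C hC hne_left) (Finset.mem_union_left _ hx) hx
  have hmem : ∀ X, X ∈ 𝒟 ↔ X = C ∪ C' ∨ X ∈ 𝒞 ∧ X ≠ C ∧ X ≠ C' := by
    intro X
    simp [h𝒟]
  have hdis_swap : Disjoint (C ×ˢ C') (C' ×ˢ C) := Finset.disjoint_product.2 (Or.inl hdis)
  have hdis_D : Disjoint (Dset 𝒞) (C ×ˢ C' ∪ C' ×ˢ C) :=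
    Finset.disjoint_union_right.2
      ⟨disjoint_Dset_product hd hC hC' hne, disjoint_Dset_product hd hC' hC hne.symm⟩
  have hD : Dset 𝒟 = Dset 𝒞 ∪ (C ×ˢ C' ∪ C' ×ˢ C) := h𝒟 ▸ Dset_merge hC hC'
  have hQ : ∀ s, Qmod m s 𝒟 = Qmod m s 𝒞 + 2 * mu m s (C ×ˢ C') := by
    intro s
    rw [Qmod, Qmod, hD, mu_union m s hdis_D, mu_union m s hdis_swap,
      mu_product_swap m hsym s C' C]
    ring
  refine ⟨?_, ?_, ?_, ?_, ?_, ?_⟩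
  · intro X hX Y hY hXY
    rcases (hmem X).1 hX with rfl | ⟨hX, hXC, hXC'⟩ <;>
      rcases (hmem Y).1 hY with rfl | ⟨hY, hYC, hYC'⟩
    · exact absurd rfl hXY
    · rw [mu_union_product m t hdis]
      exact add_nonpos (hsub C hC Y hY hYC.symm) (hsub C' hC' Y hY hYC'.symm)
    · rw [mu_product_union m t hdis]
      exact add_nonpos (hsub X hX C hC hXC) (hsub X hX C' hC' hXC')
    · exact hsub X hX Y hY hXY
  · have hpair : ({C, C'} : Finset (Finset V)) ⊆ 𝒞 := by
      simp [Finset.insert_subset_iff, hC, hC']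
    have hle := Finset.card_le_card hpair
    rw [h𝒟, Finset.card_insert_of_notMem (fun h => hnot (Finset.mem_sdiff.1 h).1),
      Finset.card_sdiff_of_subset hpair]
    rw [Finset.card_pair hne] at hle ⊢
    omega
  · let f : Finset V → Finset V := fun X => if X = C ∪ C' then C else X
    have hf_merge : f (C ∪ C') = C := if_pos rfl
    have hf_of_mem : ∀ X ∈ 𝒞, f X = X := by
      intro X hX
      exact if_neg (ne_of_mem_of_not_mem hX hnot)
    have hf_inj : ∀ X ∈ 𝒟, ∀ Y ∈ 𝒟, f X = f Y → X = Y := by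
      intro X hX Y hY hXY
      rcases (hmem X).1 hX with rfl | ⟨hX, hXC, hXC'⟩ <;>
        rcases (hmem Y).1 hY with rfl | ⟨hY, hYC, hYC'⟩
      · rfl
      · rw [hf_merge, hf_of_mem Y hY] at hXY
        exact absurd hXY.symm hYC
      · rw [hf_merge, hf_of_mem X hX] at hXY
        exact absurd hXY hXC
      · rwa [hf_of_mem X hX, hf_of_mem Y hY] at hXY
    have hf_ne : ∀ Y ∈ 𝒟, f Y ≠ C' := by
      intro Y hY
      rcases (hmem Y).1 hY with rfl | ⟨hY, -, hYC'⟩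
      · rwa [hf_merge]
      · rwa [hf_of_mem Y hY]
    have hcard : (Z0 m t 𝒟).card ≤ ((Z0 m t 𝒞).erase (C, C')).card := by
      refine Finset.card_le_card_of_injOn (Prod.map f f) ?_ ?_
      · rintro ⟨X, Y⟩ hp
        obtain ⟨⟨hX, hY⟩, hXY, h0⟩ := mem_Z0.1 hp
        simp only at hX hY hXY h0
        refine Finset.mem_coe.2 (Finset.mem_erase.2
          ⟨fun h => hf_ne Y hY (congrArg Prod.snd h), mem_Z0.2 ?_⟩)
        simp only [Prod.map_apply]
        rcases (hmem X).1 hX with rfl | ⟨hX, hXC, hXC'⟩ <;>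
          rcases (hmem Y).1 hY with rfl | ⟨hY, hYC, hYC'⟩
        · exact absurd rfl hXY
        · rw [hf_merge, hf_of_mem Y hY]
          rw [mu_union_product m t hdis] at h0
          have h1 := hsub C hC Y hY hYC.symm
          have h2 := hsub C' hC' Y hY hYC'.symm
          exact ⟨⟨hC, hY⟩, hYC.symm, by linarith⟩
        · rw [hf_merge, hf_of_mem X hX]
          rw [mu_product_union m t hdis] at h0
          have h1 := hsub X hX C hC hXC
          have h2 := hsub X hX C' hC' hXC'
          exact ⟨⟨hX, hC⟩, hXC, by linarith⟩
        · rw [hf_of_mem X hX, hf_of_mem Y hY]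
          exact ⟨⟨hX, hY⟩, hXY, h0⟩
      · rintro ⟨X, Y⟩ hp ⟨X', Y'⟩ hp' h
        obtain ⟨⟨hX, hY⟩, -⟩ := mem_Z0.1 hp
        obtain ⟨⟨hX', hY'⟩, -⟩ := mem_Z0.1 hp'
        exact Prod.ext (hf_inj X hX X' hX' (congrArg Prod.fst h))
          (hf_inj Y hY Y' hY' (congrArg Prod.snd h))
    exact hcard.trans_lt (Finset.card_erase_lt_of_mem hCC')
  · rw [hQ, hmu]
    ring
  · rw [alphaP, alphaP, hD, mVV_union m hdis_D, mVV_union m hdis_swap,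
      mVV_product_swap m C' C]
    ring
  · intro s _ hst
    have hpos : 0 < (t - s) * mVV m (C ×ˢ C') := mul_pos (sub_pos.2 hst) hVV
    rw [hQ]
    simp only [mu] at hmu ⊢
    linarith
end
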